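/- Let ψ₁ and ψ₂ be quadratic Pfister forms over a field F that are k-linked. Suppose ψ₁ ≅ φ₁ ⊗ π ≅ τ₁ ⊗ μ and ψ₂ ≅ φ₂ ⊗ π ≅ τ₂ ⊗ μ, where π and μ are k-fold quadratic Pfister forms and φ₁, φ₂, τ₁, τ₂ are bilinear Pfister forms. Then φ₁ ⊗ φ₂ ⊗ π ≅ τ₁ ⊗ τ₂ ⊗ μ. In other words, the invariant F²_k(ψ₁, ψ₂) = φ₁ ⊗ φ₂ ⊗ π is well-defined up to isometry, independent of the choice of common k-fold quadratic Pfister factor and of the bilinear Pfister cofactors. -/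

import Mathlib

noncomputable section

open QuadraticMap

/-- A quadratic form over `F` on the space `F^d`, bundled together with its dimension `d`. -/
structure QF (F : Type) [Field F] where
  dim : ℕ
  form : QuadraticForm F (Fin dim → F)

namespace QF

variable {F : Type} [Field F]

/-- Isometry of bundled quadratic forms. -/
def Equiv (q q' : QF F) : Prop := QuadraticMap.Equivalent q.form q'.form

/-- The standard linear equivalence `F^(a+b) ≃ F^a × F^b`. -/
def finSplit (F : Type) [Field F] (a b : ℕ) :
    (Fin (a + b) → F) ≃ₗ[F] (Fin a → F) × (Fin b → F) :=
  (LinearEquiv.funCongrLeft F F finSumFinEquiv).trans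
    (LinearEquiv.sumArrowLequivProdArrow _ _ F F)

/-- Orthogonal sum of bundled quadratic forms. -/
def sum (q₁ q₂ : QF F) : QF F :=
  ⟨q₁.dim + q₂.dim, (q₁.form.prod q₂.form).comp (finSplit F q₁.dim q₂.dim).toLinearMap⟩

instance : Neg (QF F) := ⟨fun q => ⟨q.dim, -q.form⟩⟩

instance : SMul F (QF F) := ⟨fun a q => ⟨q.dim, a • q.form⟩⟩

/-- `⟨⟨γ⟩⟩ ⊗ q = q ⊥ (−γ)·q` : twisting a quadratic form by the
1-fold bilinear Pfister form `⟨⟨γ⟩⟩ = ⟨1, −γ⟩`. -/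
def twist (γ : F) (q : QF F) : QF F := q.sum ((-γ) • q)

/-- `⟨⟨γ₁,…,γ_m⟩⟩ ⊗ q` : tensoring a quadratic form with the `m`-fold bilinear
Pfister form whose slots are the entries of the list `l = [γ₁,…,γ_m]`. -/
def btensor (l : List F) (q : QF F) : QF F := l.foldr twist q

/-- The zero form on the zero space. -/
def zero (F : Type) [Field F] : QF F := ⟨0, 0⟩

/-- The one-dimensional form `⟨1⟩`, `x ↦ x²`. -/
def unit (F : Type) [Field F] : QF F := ⟨1, QuadraticMap.sq.comp (LinearMap.proj 0)⟩

/-- The binary quadratic form `[1,α] : (x,y) ↦ x² + xy + αy²`. -/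
def binary (α : F) : QF F := ⟨2, (Matrix.of ![![1, 1], ![0, α]]).toQuadraticMap'⟩

/-- The hyperbolic plane `ℍ : (x,y) ↦ xy`. -/
def hyp (F : Type) [Field F] : QF F := ⟨2, (Matrix.of ![![0, 1], ![0, 0]]).toQuadraticMap'⟩

/-- `m × ℍ`, the orthogonal sum of `m` hyperbolic planes. -/
def hyps (F : Type) [Field F] : ℕ → QF F
  | 0 => zero F
  | n + 1 => (hyp F).sum (hyps F n)

/-- A quadratic form is isotropic if it represents `0` nontrivially. -/
def Isotropic (q : QF F) : Prop := ∃ v, q.form v = 0 ∧ v ≠ 0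

/-- A quadratic form is hyperbolic if it is isometric to an orthogonal
sum of hyperbolic planes. -/
def Hyperbolic (q : QF F) : Prop := ∃ m, q.Equiv (hyps F m)

/-- All entries of the list are nonzero (the slots of a bilinear Pfister form
must be units). -/
def UnitList (l : List F) : Prop := ∀ γ ∈ l, γ ≠ 0

/-- `q` is an `n`-fold quadratic Pfister form.  In characteristic `2` this means
`q ≅ ⟨⟨γ₁,…,γ_{n−1}, α]] = ⟨⟨γ₁,…,γ_{n−1}⟩⟩ ⊗ [1,α]`; in characteristic `≠ 2` it means
`q ≅ ⟨⟨γ₁,…,γ_n⟩⟩ = ⟨1,−γ₁⟩ ⊗ ⋯ ⊗ ⟨1,−γ_n⟩`. -/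
def IsQPfister (n : ℕ) (q : QF F) : Prop :=
  if ringChar F = 2 then
    ∃ (l : List F) (α : F), UnitList l ∧ l.length + 1 = n ∧ (btensor l (binary α)).Equiv q
  else
    ∃ l : List F, UnitList l ∧ l.length = n ∧ (btensor l (unit F)).Equiv q

/-- `φ` is a `k`-fold quadratic Pfister factor of `ψ`, i.e. `ψ ≅ B ⊗ φ` for some
bilinear Pfister form `B`. -/
def IsQPfisterFactor (k : ℕ) (φ ψ : QF F) : Prop :=
  IsQPfister k φ ∧ ∃ l : List F, UnitList l ∧ (btensor l φ).Equiv ψ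

/-- A finite family of quadratic Pfister forms is (separably) `k`-linked if its members
share a common `k`-fold quadratic Pfister factor. -/
def SepLinked (k : ℕ) (ψs : List (QF F)) : Prop :=
  ∃ π : QF F, IsQPfister k π ∧
    ∀ ψ ∈ ψs, ∃ l : List F, UnitList l ∧ (btensor l π).Equiv ψ

/-- A finite family of quadratic Pfister forms is inseparably `k`-linked if its members
share a common `k`-fold bilinear Pfister factor. -/
def InsepLinked (k : ℕ) (ψs : List (QF F)) : Prop :=
  ∃ l : List F, UnitList l ∧ l.length = k ∧
    ∀ ψ ∈ ψs, ∃ (n : ℕ) (π : QF F), IsQPfister n π ∧ (btensor l π).Equiv ψ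

/-- `q` is the value of the two-form invariant `F²_k(ψ₁, ψ₂) = φ₁ ⊗ φ₂ ⊗ π`
for some presentation `ψ₁ ≅ φ₁ ⊗ π`, `ψ₂ ≅ φ₂ ⊗ π`. -/
def IsPairInv (k : ℕ) (ψ₁ ψ₂ q : QF F) : Prop :=
  ∃ (π : QF F) (l₁ l₂ : List F), IsQPfister k π ∧ UnitList l₁ ∧ UnitList l₂ ∧
    (btensor l₁ π).Equiv ψ₁ ∧ (btensor l₂ π).Equiv ψ₂ ∧
    q.Equiv (btensor l₁ (btensor l₂ π))

/-- `IsInv k ψs q` : `q` is a value of the inductively defined invariant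
`F^m_k(ψ₁,…,ψ_m)`, where `F¹_k(ψ) = ψ` and
`F^m_k(ψ₁,…,ψ_m) = F²_k(F^{m−1}_k(ψ₁,…,ψ_{m−1}), ψ_m)`. -/
inductive IsInv (k : ℕ) : List (QF F) → QF F → Prop
  | single (ψ : QF F) : IsInv k [ψ] ψ
  | step {ψs : List (QF F)} {ψ q' q : QF F} :
      IsInv k ψs q' → IsPairInv k q' ψ q → IsInv k (ψs ++ [ψ]) q

end QF
namespace QF

variable {F : Type} [Field F]

/-- The (upper triangular) Gram-type matrix of a bundled quadratic form:
`q(∑ xᵢ eᵢ) = ∑ᵢ q(eᵢ) xᵢ² + ∑_{i<j} polar(eᵢ,eⱼ) xᵢ xⱼ`. -/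
def matrixOf (q : QF F) : Matrix (Fin q.dim) (Fin q.dim) F := fun i j =>
  if i = j then q.form (Pi.single i 1)
  else if i < j then polar q.form (Pi.single i 1) (Pi.single j 1)
  else 0

/-- Base change (extension of scalars) of a bundled quadratic form along a
ring homomorphism of fields. -/
def baseChange {E : Type} [Field E] (σ : F →+* E) (q : QF F) : QF E :=
  ⟨q.dim, (q.matrixOf.map σ).toQuadraticMap'⟩

/-- The homogeneous degree-2 polynomial cut out by a bundled quadratic form. -/
def toPoly (q : QF F) : MvPolynomial (Fin q.dim) F :=
  ∑ i, ∑ j, MvPolynomial.C (q.matrixOf i j) * (MvPolynomial.X i * MvPolynomial.X j)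

/-- The affine coordinate ring of the quadric `q = 0`. -/
def coordRing (q : QF F) : Type :=
  MvPolynomial (Fin q.dim) F ⧸ Ideal.span {q.toPoly}

instance (q : QF F) : CommRing q.coordRing := Ideal.Quotient.commRing _
instance (q : QF F) : Algebra F q.coordRing := Ideal.Quotient.algebra F

/-- The function field `F(q)` of the quadric `q = 0` (assuming the coordinate
ring is a domain). -/
def funField (q : QF F) : Type := FractionRing q.coordRing

instance (q : QF F) : CommRing q.funField := by unfold funField; infer_instance

noncomputable instance (q : QF F) [IsDomain q.coordRing] : Field q.funField := by
  unfold funField; infer_instance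

/-- The canonical embedding `F → F(q)`. -/
noncomputable def toFunField (q : QF F) : F →+* q.funField :=
  (algebraMap q.coordRing (FractionRing q.coordRing)).comp (algebraMap F q.coordRing)

/-- `⟨⟨γ₁,…,γ_m⟩⟩′ ⊗ q` : the tensor product with `q` of the pure part of the
bilinear Pfister form with slots `γ₁,…,γ_m`, so that
`⟨⟨l⟩⟩ ⊗ q ≅ q ⊥ (⟨⟨l⟩⟩′ ⊗ q)`. -/
def bpure : List F → QF F → QF F
  | [], _ => zero F
  | γ :: l, q => (bpure l q).sum ((-γ) • btensor l q)

end QF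

namespace QF

variable {F : Type} [Field F]

/-! ### The monoid of isometry classes -/

/-- Isometry as a setoid on bundled quadratic forms. -/
def isometrySetoid (F : Type) [Field F] : Setoid (QF F) where
  r := Equiv
  iseqv := ⟨fun q => QuadraticMap.Equivalent.refl q.form, fun h => h.symm, fun h h' => h.trans h'⟩

/-- The type of isometry classes of quadratic forms over `F`. -/
def IsoClass (F : Type) [Field F] : Type := Quotient (isometrySetoid F)

/-- The isometry class of a quadratic form. -/
def cls (q : QF F) : IsoClass F := Quotient.mk (isometrySetoid F) q

theorem cls_eq_iff {q q' : QF F} : cls q = cls q' ↔ q.Equiv q' :=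
  Quotient.eq (r := isometrySetoid F)

/-- The underlying space of `q₁ ⊥ q₂` is the product of the underlying spaces. -/
def sumIsometry (q₁ q₂ : QF F) : (q₁.sum q₂).form.IsometryEquiv (q₁.form.prod q₂.form) where
  toLinearEquiv := finSplit F q₁.dim q₂.dim
  map_app' _ := rfl

theorem sum_equiv_prod (q₁ q₂ : QF F) : (q₁.sum q₂).form.Equivalent (q₁.form.prod q₂.form) :=
  ⟨sumIsometry q₁ q₂⟩

theorem Equiv.sum {p p' q q' : QF F} (hp : p.Equiv p') (hq : q.Equiv q') :
    (p.sum q).Equiv (p'.sum q') := by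
  obtain ⟨e⟩ := hp
  obtain ⟨f⟩ := hq
  exact (sum_equiv_prod p q).trans (.trans ⟨e.prod f⟩ (sum_equiv_prod p' q').symm)

theorem Equiv.smul {q q' : QF F} (a : F) (h : q.Equiv q') : (a • q).Equiv (a • q') := by
  obtain ⟨e⟩ := h
  exact ⟨⟨e.toLinearEquiv, fun v => congrArg (a * ·) (e.map_app v)⟩⟩

instance : Add (IsoClass F) := ⟨Quotient.map₂ sum fun _ _ h _ _ h' => Equiv.sum h h'⟩

instance : SMul F (IsoClass F) := ⟨fun a => Quotient.map (a • ·) fun _ _ h => Equiv.smul a h⟩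

instance : Zero (IsoClass F) := ⟨cls (zero F)⟩

theorem cls_sum (p q : QF F) : cls (p.sum q) = cls p + cls q := rfl

theorem cls_smul (a : F) (q : QF F) : cls (a • q) = a • cls q := rfl

theorem sum_comm_equiv (p q : QF F) : (p.sum q).Equiv (q.sum p) :=
  (sum_equiv_prod p q).trans
    (.trans ⟨QuadraticMap.IsometryEquiv.prodComm _ _⟩ (sum_equiv_prod q p).symm)

theorem sum_assoc_equiv (p q r : QF F) : ((p.sum q).sum r).Equiv (p.sum (q.sum r)) :=
  (sum_equiv_prod _ r).trans <|
    .trans ⟨(sumIsometry p q).prod (.refl r.form)⟩ <|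
    .trans ⟨⟨LinearEquiv.prodAssoc F _ _ _, fun _ => (add_assoc _ _ _).symm⟩⟩ <|
    .trans ⟨(QuadraticMap.IsometryEquiv.refl p.form).prod (sumIsometry q r).symm⟩
      (sum_equiv_prod p _).symm

theorem zero_sum_equiv (q : QF F) : ((zero F).sum q).Equiv q := by
  refine (sum_equiv_prod _ q).trans ⟨⟨LinearEquiv.uniqueProd (M₂ := Fin 0 → F), fun v => ?_⟩⟩
  change q.form v.2 = 0 + q.form v.2
  rw [zero_add]

theorem smul_sum_equiv (a : F) (p q : QF F) : (a • p.sum q).Equiv ((a • p).sum (a • q)) :=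
  ⟨⟨.refl _ _, fun _ => (mul_add a _ _).symm⟩⟩

theorem smul_zero_equiv (a : F) : (a • zero F).Equiv (zero F) :=
  ⟨⟨.refl _ _, fun _ => (mul_zero a).symm⟩⟩

theorem mul_smul_equiv (a b : F) (q : QF F) : ((a * b) • q).Equiv (a • b • q) :=
  ⟨⟨.refl _ _, fun _ => (mul_assoc a b _).symm⟩⟩

theorem one_smul_equiv (q : QF F) : ((1 : F) • q).Equiv q :=
  ⟨⟨.refl _ _, fun _ => (one_mul _).symm⟩⟩

instance : AddCommMonoid (IsoClass F) where
  add_assoc := by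
    rintro ⟨p⟩ ⟨q⟩ ⟨r⟩
    exact cls_eq_iff.2 (sum_assoc_equiv p q r)
  zero_add := by
    rintro ⟨q⟩
    exact cls_eq_iff.2 (zero_sum_equiv q)
  add_zero := by
    rintro ⟨q⟩
    exact cls_eq_iff.2 (.trans (sum_comm_equiv q _) (zero_sum_equiv q))
  add_comm := by
    rintro ⟨p⟩ ⟨q⟩
    exact cls_eq_iff.2 (sum_comm_equiv p q)
  nsmul := nsmulRec

instance : DistribMulAction F (IsoClass F) where
  one_smul := by
    rintro ⟨q⟩
    exact cls_eq_iff.2 (one_smul_equiv q)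
  mul_smul := by
    rintro a b ⟨q⟩
    exact cls_eq_iff.2 (mul_smul_equiv a b q)
  smul_zero a := cls_eq_iff.2 (smul_zero_equiv a)
  smul_add := by
    rintro a ⟨p⟩ ⟨q⟩
    exact cls_eq_iff.2 (smul_sum_equiv a p q)

/-- `⟨a, b⟩ ⊗ q ≅ ⟨a + b, ab(a + b)⟩ ⊗ q` whenever `a + b ≠ 0`. -/
theorem smul_add_smul (a b : F) (h : a + b ≠ 0) (x : IsoClass F) :
    a • x + b • x = (a + b) • x + (a * b * (a + b)) • x := by
  obtain ⟨q⟩ := x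
  refine Eq.symm (cls_eq_iff.2 ((sum_equiv_prod ((a + b) • q) ((a * b * (a + b)) • q)).trans
    (.trans ?_ (sum_equiv_prod (a • q) (b • q)).symm)))
  let V := Fin q.dim → F
  let f : V × V →ₗ[F] V × V :=
    (LinearMap.fst F V V + b • LinearMap.snd F V V).prod
      (LinearMap.fst F V V - a • LinearMap.snd F V V)
  let g : V × V →ₗ[F] V × V :=
    ((a + b)⁻¹ • (a • LinearMap.fst F V V + b • LinearMap.snd F V V)).prod
      ((a + b)⁻¹ • (LinearMap.fst F V V - LinearMap.snd F V V))
  have hfg : f ∘ₗ g = LinearMap.id := by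
    refine LinearMap.ext fun v => Prod.ext (funext fun i => ?_) (funext fun i => ?_)
    · change (a + b)⁻¹ * (a * v.1 i + b * v.2 i) + b * ((a + b)⁻¹ * (v.1 i - v.2 i)) = v.1 i
      field_simp
      ring
    · change (a + b)⁻¹ * (a * v.1 i + b * v.2 i) - a * ((a + b)⁻¹ * (v.1 i - v.2 i)) = v.2 i
      field_simp
      ring
  have hgf : g ∘ₗ f = LinearMap.id := by
    refine LinearMap.ext fun v => Prod.ext (funext fun i => ?_) (funext fun i => ?_)
    · change (a + b)⁻¹ * (a * (v.1 i + b * v.2 i) + b * (v.1 i - a * v.2 i)) = v.1 i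
      field_simp
      ring
    · change (a + b)⁻¹ * ((v.1 i + b * v.2 i) - (v.1 i - a * v.2 i)) = v.2 i
      field_simp
      ring
  refine ⟨⟨LinearEquiv.ofLinearMap f g hfg hgf, fun v => ?_⟩⟩
  change a * q.form (v.1 + b • v.2) + b * q.form (v.1 - a • v.2)
    = (a + b) * q.form v.1 + (a * b * (a + b)) * q.form v.2
  rw [sub_eq_add_neg, ← neg_smul, QuadraticMap.map_add q.form, QuadraticMap.map_add q.form,
    QuadraticMap.map_smul, QuadraticMap.map_smul, QuadraticMap.polar_smul_right,
    QuadraticMap.polar_smul_right]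
  simp only [smul_eq_mul]
  ring

/-! ### Twisting by bilinear Pfister forms -/

theorem cls_twist (γ : F) (q : QF F) : cls (twist γ q) = cls q + (-γ) • cls q := rfl

theorem btensor_cons (γ : F) (l : List F) (q : QF F) :
    btensor (γ :: l) q = twist γ (btensor l q) := rfl

theorem btensor_append (l t : List F) (q : QF F) :
    btensor (l ++ t) q = btensor l (btensor t q) :=
  List.foldr_append

theorem cls_twist_congr (γ : F) {q q' : QF F} (h : cls q = cls q') :
    cls (twist γ q) = cls (twist γ q') := by
  rw [cls_twist, cls_twist, h]

theorem cls_btensor_congr (l : List F) {q q' : QF F} (h : cls q = cls q') :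
    cls (btensor l q) = cls (btensor l q') := by
  induction l with
  | nil => exact h
  | cons γ l ih => exact cls_twist_congr γ ih

theorem cls_twist_twist_comm (γ δ : F) (q : QF F) :
    cls (twist γ (twist δ q)) = cls (twist δ (twist γ q)) := by
  simp only [cls_twist, smul_add, smul_smul, mul_comm (-γ)]
  abel

theorem cls_twist_btensor_comm (γ : F) (l : List F) (q : QF F) :
    cls (twist γ (btensor l q)) = cls (btensor l (twist γ q)) := by
  induction l with
  | nil => rfl
  | cons δ l ih =>
    rw [btensor_cons, cls_twist_twist_comm, btensor_cons]
    exact cls_twist_congr δ ih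

theorem cls_btensor_comm (l t : List F) (q : QF F) :
    cls (btensor l (btensor t q)) = cls (btensor t (btensor l q)) := by
  induction l with
  | nil => rfl
  | cons γ l ih =>
    rw [btensor_cons, cls_twist_congr γ ih, cls_twist_btensor_comm, btensor_cons]

/-- `⟨⟨e, f⟩⟩ ⊗ q ≅ ⟨⟨e + f, -ef⟩⟩ ⊗ q`. -/
theorem cls_twist_twist_add (e f : F) (h : e + f ≠ 0) (q : QF F) :
    cls (twist e (twist f q)) = cls (twist (e + f) (twist (-(e * f)) q)) := by
  have key := smul_add_smul (-e) (-f) (by rwa [← neg_add, neg_ne_zero]) (cls q)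
  simp only [cls_twist, smul_add, smul_smul]
  calc cls q + -f • cls q + (-e • cls q + (-e * -f) • cls q)
      = cls q + (-e * -f) • cls q + (-e • cls q + -f • cls q) := by abel
    _ = _ := by
      rw [key]
      ring_nf

theorem cls_btensor_eq (l : List F) (q : QF F) :
    cls (btensor l q) = cls q + cls (bpure l q) := by
  induction l with
  | nil => exact (add_zero _).symm
  | cons γ l ih =>
    rw [btensor_cons, cls_twist, bpure, cls_sum, cls_smul, ← add_assoc, ← ih]

theorem dim_btensor (l : List F) (q : QF F) : (btensor l q).dim = 2 ^ l.length * q.dim := by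
  induction l with
  | nil => simp [btensor]
  | cons γ l ih =>
    change (btensor l q).dim + (btensor l q).dim = _
    rw [ih, List.length_cons]
    ring

theorem Equiv.dim_eq {q q' : QF F} (h : q.Equiv q') : q.dim = q'.dim := by
  obtain ⟨e⟩ := h
  simpa using e.toLinearEquiv.finrank_eq

theorem dim_bpure (l : List F) (q : QF F) :
    q.dim + (bpure l q).dim = 2 ^ l.length * q.dim := by
  rw [← dim_btensor, (cls_eq_iff.1 (cls_btensor_eq l q)).dim_eq]
  rfl

/-! ### Nondegenerate and round forms -/

/-- The polar form of `q` is nondegenerate. -/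
def Nondeg (q : QF F) : Prop := ∀ v, v ≠ 0 → ∃ w, polar q.form v w ≠ 0

theorem Nondeg.congr {q q' : QF F} (h : q.Equiv q') (hq : q.Nondeg) : q'.Nondeg := by
  obtain ⟨e⟩ := h
  intro v hv
  obtain ⟨w, hw⟩ := hq (e.symm v) (by simpa using hv)
  refine ⟨e w, ?_⟩
  have hv : e (e.symm v) = v := e.apply_symm_apply v
  rw [← hv, polar, ← map_add, e.map_app, e.map_app, e.map_app]
  exact hw

theorem Nondeg.smul {q : QF F} {a : F} (ha : a ≠ 0) (hq : q.Nondeg) : (a • q).Nondeg := by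
  intro v hv
  obtain ⟨w, hw⟩ := hq v hv
  refine ⟨w, ?_⟩
  change polar (a • q.form) v w ≠ 0
  rw [FunLike.coe_smul, polar_smul]
  exact mul_ne_zero ha hw

theorem Nondeg.sum {p q : QF F} (hp : p.Nondeg) (hq : q.Nondeg) : (p.sum q).Nondeg := by
  intro (v : Fin (p.dim + q.dim) → F) hv
  let s := finSplit F p.dim q.dim
  have key : ∀ w, polar (p.sum q).form v (s.symm w)
      = polar p.form (s v).1 w.1 + polar q.form (s v).2 w.2 := by
    intro w
    have h1 : s (v + s.symm w) = s v + w := by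
      rw [map_add, s.apply_symm_apply]
    have h2 : s (s.symm w) = w := s.apply_symm_apply w
    change p.form (s (v + s.symm w)).1 + q.form (s (v + s.symm w)).2
      - (p.form (s v).1 + q.form (s v).2) - (p.form (s (s.symm w)).1 + q.form (s (s.symm w)).2) = _
    rw [h1, h2, polar, polar, Prod.fst_add, Prod.snd_add]
    ring
  by_cases h : (s v).1 = 0
  · have h2 : (s v).2 ≠ 0 := fun h2 => hv (s.map_eq_zero_iff.1 (Prod.ext h h2))
    obtain ⟨w, hw⟩ := hq _ h2
    exact ⟨s.symm (0, w), by rw [key]; simpa using hw⟩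
  · obtain ⟨w, hw⟩ := hp _ h
    exact ⟨s.symm (w, 0), by rw [key]; simpa using hw⟩

/-- An isotropic nondegenerate form is universal. -/
theorem Nondeg.exists_eq {q : QF F} (hq : q.Nondeg) {v : Fin q.dim → F} (hv : v ≠ 0)
    (h0 : q.form v = 0) (c : F) : ∃ u, q.form u = c := by
  obtain ⟨w, hw⟩ := hq v hv
  refine ⟨w + ((c - q.form w) / polar q.form v w) • v, ?_⟩
  rw [QuadraticMap.map_add q.form, QuadraticMap.map_smul, h0, QuadraticMap.polar_smul_right,
    polar_comm q.form w v, smul_eq_mul, smul_eq_mul, div_mul_cancel₀ _ hw]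
  ring

/-- The properties of quadratic Pfister forms used below: they are nondegenerate, represent
`1`, and are round. -/
structure Round (q : QF F) : Prop where
  nondeg : q.Nondeg
  exists_one : ∃ v, q.form v = 1
  smul_cls : ∀ v, q.form v ≠ 0 → q.form v • cls q = cls q

theorem Round.congr {q q' : QF F} (h : q.Equiv q') (hq : q.Round) : q'.Round := by
  refine ⟨hq.nondeg.congr h, ?_, ?_⟩
  · obtain ⟨e⟩ := h
    obtain ⟨v, hv⟩ := hq.exists_one
    exact ⟨e v, (e.map_app v).trans hv⟩
  · intro v hv
    rw [← cls_eq_iff.2 h]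
    obtain ⟨e⟩ := h
    rw [← e.symm.map_app v] at hv ⊢
    exact hq.smul_cls _ hv

theorem sq_smul_cls {c : F} (hc : c ≠ 0) (q : QF F) : (c * c) • cls q = cls q :=
  cls_eq_iff.2 ⟨⟨LinearEquiv.smulOfNeZero F _ c hc, fun v => q.form.map_smul c v⟩⟩

theorem Round.twist {q : QF F} {γ : F} (hγ : γ ≠ 0) (hq : q.Round) : (twist γ q).Round := by
  refine ⟨hq.nondeg.sum (hq.nondeg.smul (neg_ne_zero.2 hγ)), ?_, ?_⟩
  · obtain ⟨v, hv⟩ := hq.exists_one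
    let s := finSplit F q.dim q.dim
    refine ⟨s.symm (v, 0), ?_⟩
    have hs : s (s.symm (v, 0)) = (v, 0) := s.apply_symm_apply _
    change q.form (s (s.symm (v, 0))).1 + -γ * q.form (s (s.symm (v, 0))).2 = 1
    rw [hs, hv, QuadraticMap.map_zero, mul_zero, add_zero]
  · intro v hv
    set x := (finSplit F q.dim q.dim v).1
    set y := (finSplit F q.dim q.dim v).2
    have hval : (QF.twist γ q).form v = q.form x + -γ * q.form y := rfl
    rw [hval] at hv ⊢
    have hx := hq.smul_cls x
    have hy := hq.smul_cls y
    generalize q.form x = a at *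
    generalize q.form y = b at *
    rw [cls_twist]
    by_cases hb : b = 0
    · subst hb
      rw [mul_zero, add_zero] at hv ⊢
      rw [smul_add, smul_comm, hx hv]
    by_cases ha : a = 0
    · subst ha
      rw [zero_add, mul_comm, mul_smul, smul_add, smul_add, smul_smul (-γ) (-γ),
        sq_smul_cls (neg_ne_zero.2 hγ), smul_comm b (-γ), hy hb, add_comm]
    · have key := smul_add_smul a (-γ * b) hv (cls q)
      rw [hx ha, mul_smul (-γ), hy hb] at key
      rw [smul_add, smul_smul, key]
      congr 1
      have hab : (a * b) • cls q = cls q := by rw [mul_smul, hy hb, hx ha]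
      conv_lhs => rw [← hab, smul_smul]
      congr 1
      ring

theorem Round.btensor {q : QF F} {l : List F} (hl : UnitList l) (hq : q.Round) :
    (btensor l q).Round := by
  induction l with
  | nil => exact hq
  | cons γ l ih =>
    exact (ih fun δ hδ => hl δ (List.mem_cons_of_mem _ hδ)).twist (hl γ List.mem_cons_self)

/-! ### Quadratic Pfister forms are round -/

theorem unit_form_apply (v : Fin (unit F).dim → F) :
    (unit F).form v = v (0 : Fin 1) * v (0 : Fin 1) := rfl

theorem round_unit (h2 : (2 : F) ≠ 0) : (unit F).Round := by
  refine ⟨fun v hv => ⟨v, ?_⟩, ⟨fun _ => 1, mul_one 1⟩, fun v hv => ?_⟩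
  · have h0 : v (0 : Fin 1) ≠ 0 := fun h => hv (funext fun i => by
      rw [Subsingleton.elim (α := Fin 1) i 0, h]; rfl)
    have : polar (unit F).form v v = 2 * (v (0 : Fin 1) * v (0 : Fin 1)) := by
      change (v (0 : Fin 1) + v (0 : Fin 1)) * (v (0 : Fin 1) + v (0 : Fin 1))
        - v (0 : Fin 1) * v (0 : Fin 1) - v (0 : Fin 1) * v (0 : Fin 1) = _
      ring
    rw [this]
    exact mul_ne_zero h2 (mul_ne_zero h0 h0)
  · rw [unit_form_apply] at hv ⊢
    exact sq_smul_cls (left_ne_zero_of_mul hv) _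

theorem binary_form_apply (α : F) (v : Fin 2 → F) :
    (binary α).form v = v 0 * v 0 + v 0 * v 1 + α * (v 1 * v 1) := by
  change (!![1, 1; 0, α] : Matrix (Fin 2) (Fin 2) F).toQuadraticForm' v = _
  simp [Matrix.toQuadraticForm', Matrix.toLinearMap₂'_apply, Fin.sum_univ_two]
  ring

/-- Multiplication by `a + bθ` on `F[θ]`, where `θ² = θ - α`. -/
def quadMul (α a b : F) : (Fin 2 → F) →ₗ[F] (Fin 2 → F) :=
  Matrix.toLin' !![a, -(α * b); b, a + b]

theorem quadMul_apply (α a b : F) (v : Fin 2 → F) :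
    quadMul α a b v = ![a * v 0 + -(α * b) * v 1, b * v 0 + (a + b) * v 1] := by
  ext i
  fin_cases i <;> simp [quadMul, Matrix.mulVec, dotProduct, Fin.sum_univ_two]

theorem quadMul_injective (α a b : F) (h : a * a + a * b + α * (b * b) ≠ 0) :
    Function.Injective (quadMul α a b) := by
  refine (injective_iff_map_eq_zero _).2 fun v hv => ?_
  rw [quadMul_apply] at hv
  have h0 : a * v 0 + -(α * b) * v 1 = 0 := congrFun hv 0
  have h1 : b * v 0 + (a + b) * v 1 = 0 := congrFun hv 1
  ext i
  refine (mul_eq_zero.1 (?_ : (a * a + a * b + α * (b * b)) * v i = 0)).resolve_left h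
  fin_cases i
  · change _ * v 0 = 0
    linear_combination (a + b) * h0 + α * b * h1
  · change _ * v 1 = 0
    linear_combination a * h1 - b * h0

theorem round_binary (h2 : (2 : F) = 0) (α : F) : (binary α).Round := by
  refine ⟨fun (v : Fin 2 → F) hv => ?_, ⟨(![1, 0] : Fin 2 → F), ?_⟩,
    fun (v : Fin 2 → F) hv => ?_⟩
  · have key : ∀ w : Fin 2 → F,
        polar (binary α).form v w = v 0 * w 1 + v 1 * w 0 := by
      intro w
      have : polar (binary α).form v w = (binary α).form (v + w)
        - (binary α).form v - (binary α).form w := rfl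
      rw [this, binary_form_apply, binary_form_apply, binary_form_apply]
      simp only [Pi.add_apply]
      linear_combination (v 0 * w 0 + α * (v 1 * w 1)) * h2
    by_cases h0 : v 0 = 0
    · refine ⟨(![1, 0] : Fin 2 → F), ?_⟩
      rw [key]
      intro h
      have h1 : v 1 = 0 := by simpa using h
      refine hv (funext fun i : Fin 2 => ?_)
      fin_cases i
      · exact h0
      · exact h1
    · exact ⟨(![0, 1] : Fin 2 → F), by rw [key]; simpa using h0⟩
  · rw [binary_form_apply]
    simp
  · rw [binary_form_apply] at hv ⊢
    refine cls_eq_iff.2 ⟨⟨LinearEquiv.ofInjectiveEndo _ (quadMul_injective α _ _ hv),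
      fun (w : Fin 2 → F) => ?_⟩⟩
    change (binary α).form (quadMul α _ _ w) = _ * (binary α).form w
    rw [quadMul_apply, binary_form_apply, binary_form_apply]
    simp only [Matrix.cons_val_zero, Matrix.cons_val_one]
    ring

theorem IsQPfister.round {k : ℕ} {q : QF F} (h : IsQPfister k q) : q.Round := by
  unfold IsQPfister at h
  split_ifs at h with hF
  · obtain ⟨l, α, hl, -, e⟩ := h
    have : CharP F 2 := ringChar.of_eq hF
    exact ((round_binary CharTwo.two_eq_zero α).btensor hl).congr e
  · obtain ⟨l, hl, -, e⟩ := h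
    exact ((round_unit (Ring.two_ne_zero hF)).btensor hl).congr e

theorem IsQPfister.dim_eq {k : ℕ} {q : QF F} (h : IsQPfister k q) : q.dim = 2 ^ k := by
  unfold IsQPfister at h
  split_ifs at h with hF
  · obtain ⟨l, α, -, rfl, e⟩ := h
    rw [← e.dim_eq, dim_btensor, pow_succ]
    rfl
  · obtain ⟨l, -, rfl, e⟩ := h
    rw [← e.dim_eq, dim_btensor]
    exact mul_one _

/-! ### Common slots -/

theorem Nondeg.bpure {q : QF F} {l : List F} (hl : UnitList l) (hq : q.Round) :
    (bpure l q).Nondeg := by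
  induction l with
  | nil => exact fun v hv => (hv (Subsingleton.elim (α := Fin 0 → F) v 0)).elim
  | cons γ l ih =>
    have hl' : UnitList l := fun δ hδ => hl δ (List.mem_cons_of_mem _ hδ)
    exact (ih hl').sum ((hq.btensor hl').nondeg.smul (neg_ne_zero.2 (hl γ List.mem_cons_self)))

/-- If `-d ≠ 0` is a value of the pure part of `⟨⟨l⟩⟩ ⊗ q`, then `d` is a slot. -/
theorem exists_slot {q : QF F} (hq : q.Round) {l : List F} (hl : UnitList l)
    (v : Fin (bpure l q).dim → F) (hv : (bpure l q).form v ≠ 0) :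
    ∃ l', UnitList l' ∧ l'.length + 1 = l.length ∧
      cls (btensor l q) = cls (twist (-(bpure l q).form v) (btensor l' q)) := by
  induction l with
  | nil => exact (hv rfl).elim
  | cons γ l ih =>
    have hl' : UnitList l := fun δ hδ => hl δ (List.mem_cons_of_mem _ hδ)
    have hγ : γ ≠ 0 := hl γ List.mem_cons_self
    set x := (finSplit F (bpure l q).dim (btensor l q).dim v).1
    set y := (finSplit F (bpure l q).dim (btensor l q).dim v).2
    have hval : (bpure (γ :: l) q).form v = (bpure l q).form x + -γ * (btensor l q).form y := rfl
    rw [hval] at hv ⊢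
    have hx := ih hl' x
    have hy := (hq.btensor hl').smul_cls y
    generalize (bpure l q).form x = e at *
    generalize (btensor l q).form y = f at *
    by_cases hf : f = 0
    · subst hf
      rw [mul_zero, add_zero] at hv ⊢
      obtain ⟨l', hu, hlen, h⟩ := hx hv
      refine ⟨γ :: l', List.forall_mem_cons.2 ⟨hγ, hu⟩, by simp [hlen], ?_⟩
      rw [btensor_cons, btensor_cons, cls_twist_congr γ h, cls_twist_twist_comm]
    have hγf : cls (btensor (γ :: l) q) = cls (twist (γ * f) (btensor l q)) := by
      rw [btensor_cons, cls_twist, cls_twist, ← neg_mul, mul_smul, hy hf]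
    rw [hγf]
    by_cases he : e = 0
    · subst he
      refine ⟨l, hl', rfl, ?_⟩
      rw [zero_add, neg_mul, neg_neg]
    · obtain ⟨l', hu, hlen, h⟩ := hx he
      have hd : -(e + -γ * f) = -e + γ * f := by ring
      refine ⟨-(-e * (γ * f)) :: l', List.forall_mem_cons.2 ⟨?_, hu⟩, by simp [hlen], ?_⟩
      · simp [he, hγ, hf]
      · rw [cls_twist_congr _ h, cls_twist_twist_comm, btensor_cons, hd]
        exact cls_twist_twist_add _ _ (hd ▸ neg_ne_zero.2 hv) _

/-- If `p ⊥ A ≅ q ⊥ B`, where `p` and `q` both represent `1` and `dim p ≤ dim A`, then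
`A ⊥ -B` is isotropic. -/
theorem exists_common_value {p q A B : QF F} (h : (p.sum A).Equiv (q.sum B))
    (hp : ∃ x, p.form x = 1) (hq : ∃ y, q.form y = 1) (hqn : q.Nondeg)
    (hpq : p.dim = q.dim) (hA : p.dim ≤ A.dim) :
    ∃ a b, (a ≠ 0 ∨ b ≠ 0) ∧ A.form a = B.form b := by
  have hdim : p.dim + A.dim = q.dim + B.dim := h.dim_eq
  obtain ⟨e⟩ := (sum_equiv_prod p A).symm.trans (h.trans (sum_equiv_prod q B))
  obtain ⟨x, hx⟩ := hp
  obtain ⟨y, hy⟩ := hq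
  let V := (Fin q.dim → F) × (Fin B.dim → F)
  let Q : QuadraticForm F V := q.form.prod B.form
  have hQ : ∀ u b, Q (u, b) = q.form u + B.form b := fun _ _ => rfl
  have heQ : ∀ u a, Q (e (u, a)) = p.form u + A.form a := fun u a => e.map_app (u, a)
  let L : (Fin A.dim → F) × (Fin B.dim → F) →ₗ[F] V :=
    (e.toLinearEquiv.toLinearMap ∘ₗ LinearMap.inr F _ _).coprod (-LinearMap.inr F _ _)
  have hL : ∀ a b, L (a, b) = e (0, a) - (0, b) := fun a b => (sub_eq_add_neg _ _).symm
  by_cases hxy : e (x, 0) = (y, 0)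
  · suffices ¬ Function.Injective L by
      obtain ⟨⟨a, b⟩, hab, hne⟩ := (LinearMap.ker L).exists_mem_ne_zero_of_ne_bot
        (mt LinearMap.ker_eq_bot.1 this)
      have hab' : e (0, a) = (0, b) := sub_eq_zero.1 ((hL a b).symm.trans hab)
      refine ⟨a, b, ?_, ?_⟩
      · by_contra! hc
        exact hne (Prod.ext hc.1 hc.2)
      · have := heQ 0 a
        rw [hab', hQ, QuadraticMap.map_zero, QuadraticMap.map_zero, zero_add, zero_add] at this
        exact this.symm
    intro hinj
    have hsurj : Function.Surjective L := by
      refine (LinearMap.injective_iff_surjective_of_finrank_eq_finrank ?_).1 hinj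
      have := LinearMap.finrank_le_finrank_of_injective hinj
      simp only [V, Module.finrank_prod, Module.finrank_fin_fun] at this ⊢
      omega
    have hy0 : y ≠ 0 := by
      rintro rfl
      simp at hy
    obtain ⟨w, hw⟩ := hqn y hy0
    obtain ⟨⟨a, b⟩, hab⟩ := hsurj (w, 0)
    rw [hL, sub_eq_iff_eq_add] at hab
    have h1 : Q (e (x, a)) = Q (e (x, 0)) + Q (e (0, a)) := by
      simp [heQ]
    have h2 : e (x, a) = e (x, 0) + e (0, a) := by
      rw [← map_add, Prod.mk_add_mk, add_zero, zero_add]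
    rw [h2, hab, hxy, Prod.mk_add_mk, Prod.mk_add_mk, hQ, hQ, hQ, add_zero, zero_add, zero_add,
      QuadraticMap.map_zero] at h1
    apply hw
    rw [polar]
    linear_combination h1
  · let M : ((Fin A.dim → F) × (Fin B.dim → F)) × F →ₗ[F] V :=
      L.coprod (LinearMap.toSpanSingleton F V (e (x, 0) - (y, 0)))
    have hM : ¬ Function.Injective M := by
      intro hinj
      have := LinearMap.finrank_le_finrank_of_injective hinj
      simp only [V, Module.finrank_prod, Module.finrank_fin_fun, Module.finrank_self] at this
      omega
    obtain ⟨⟨⟨a, b⟩, t⟩, hab, hne⟩ := (LinearMap.ker M).exists_mem_ne_zero_of_ne_bot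
      (mt LinearMap.ker_eq_bot.1 hM)
    have hab' : L (a, b) + t • (e (x, 0) - (y, 0)) = 0 := hab
    have key : e (t • x, a) = (t • y, b) := by
      have h2 : e (t • x, a) = t • e (x, 0) + e (0, a) := by
        rw [← map_smul, ← map_add]
        simp
      have h3 : ((t • y, b) : V) = t • (y, 0) + (0, b) := by simp
      rw [h2, h3, ← sub_eq_zero, ← hab', hL, smul_sub]
      abel
    refine ⟨a, b, ?_, ?_⟩
    · by_contra! hc
      obtain ⟨rfl, rfl⟩ := hc
      have h0 : L (0, 0) = 0 := map_zero L
      rw [h0, zero_add, smul_eq_zero, sub_eq_zero] at hab'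
      exact hne (Prod.ext rfl (hab'.resolve_right hxy))
    · have := heQ (t • x) a
      rw [key, hQ, QuadraticMap.map_smul, QuadraticMap.map_smul, hx, hy] at this
      exact (add_left_cancel this).symm

/-- The pure part of `⟨⟨l⟩⟩ ⊗ q` takes a nonzero value when `l` is nonempty. -/
theorem exists_bpure_ne_zero {q : QF F} (hq : q.Round) {l : List F} (hl : UnitList l)
    (h : l ≠ []) : ∃ v, (bpure l q).form v ≠ 0 := by
  cases l with
  | nil => exact (h rfl).elim
  | cons γ l =>
    have hl' : UnitList l := fun δ hδ => hl δ (List.mem_cons_of_mem _ hδ)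
    obtain ⟨v, hv⟩ := (hq.btensor hl').exists_one
    let s := finSplit F (bpure l q).dim (btensor l q).dim
    refine ⟨s.symm (0, v), ?_⟩
    have hs : s (s.symm (0, v)) = (0, v) := s.apply_symm_apply _
    change (bpure l q).form (s (s.symm (0, v))).1
      + -γ * (btensor l q).form (s (s.symm (0, v))).2 ≠ 0
    rw [hs, QuadraticMap.map_zero, hv, zero_add, mul_one]
    exact neg_ne_zero.2 (hl γ List.mem_cons_self)

/-- Isometric multiples of `p` and `q` by bilinear Pfister forms of the same positive rank
admit a common slot. -/
theorem exists_common_slot {p q : QF F} (hp : p.Round) (hq : q.Round) (hpq : p.dim = q.dim)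
    {l t : List F} (hl : UnitList l) (ht : UnitList t) (hlt : l.length = t.length) (hne : l ≠ [])
    (h : (btensor l p).Equiv (btensor t q)) :
    ∃ (d : F) (l' t' : List F), d ≠ 0 ∧ UnitList l' ∧ UnitList t' ∧
      l'.length + 1 = l.length ∧ t'.length + 1 = t.length ∧
      cls (btensor l p) = cls (twist d (btensor l' p)) ∧
      cls (btensor t q) = cls (twist d (btensor t' q)) := by
  have hne' : t ≠ [] := by
    rw [← List.length_pos_iff] at hne ⊢
    omega
  suffices ∃ a b, (bpure l p).form a = (bpure t q).form b ∧ (bpure l p).form a ≠ 0 by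
    obtain ⟨a, b, hab, ha⟩ := this
    obtain ⟨l', hl', hlen, e⟩ := exists_slot hp hl a ha
    obtain ⟨t', ht', hlen', e'⟩ := exists_slot hq ht b (hab ▸ ha)
    exact ⟨_, l', t', neg_ne_zero.2 ha, hl', ht', hlen, hlen', e, hab ▸ e'⟩
  have h' : (p.sum (bpure l p)).Equiv (q.sum (bpure t q)) := by
    rw [← cls_eq_iff, cls_sum, cls_sum, ← cls_btensor_eq, ← cls_btensor_eq, cls_eq_iff]
    exact h
  have hdim : p.dim ≤ (bpure l p).dim := by
    have h1 := dim_bpure l p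
    have h2 : 2 ^ 1 ≤ 2 ^ l.length := Nat.pow_le_pow_right (by norm_num) (List.length_pos_iff.2 hne)
    have h3 := Nat.mul_le_mul_right p.dim h2
    omega
  obtain ⟨a, b, hab, hval⟩ :=
    exists_common_value h' hp.exists_one hq.exists_one hq.nondeg hpq hdim
  by_cases h0 : (bpure l p).form a = 0
  · rcases hab with ha | hb
    · obtain ⟨b', hb'⟩ := exists_bpure_ne_zero hq ht hne'
      obtain ⟨a', ha'⟩ := (Nondeg.bpure hl hp).exists_eq ha h0 ((bpure t q).form b')
      exact ⟨a', b', ha', ha' ▸ hb'⟩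
    · obtain ⟨a', ha'⟩ := exists_bpure_ne_zero hp hl hne
      obtain ⟨b', hb'⟩ := (Nondeg.bpure ht hq).exists_eq hb (hval ▸ h0) ((bpure l p).form a')
      exact ⟨a', b', hb'.symm, ha'⟩
  · exact ⟨a, b, hval, h0⟩

/-- Two quadratic Pfister factors of the same dimension of a quadratic Pfister form have a
common bilinear Pfister cofactor. -/
theorem exists_common_cofactor {p q : QF F} (hp : p.Round) (hq : q.Round) (hpq : p.dim = q.dim)
    {l t : List F} (hl : UnitList l) (ht : UnitList t) (hlt : l.length = t.length)
    (h : (btensor l p).Equiv (btensor t q)) :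
    ∃ s, cls (btensor l p) = cls (btensor s p) ∧ cls (btensor t q) = cls (btensor s q) := by
  induction hr : l.length generalizing p q l t with
  | zero =>
    obtain rfl := List.eq_nil_of_length_eq_zero hr
    obtain rfl := List.eq_nil_of_length_eq_zero (hlt ▸ hr)
    exact ⟨[], rfl, rfl⟩
  | succ r ih =>
    obtain ⟨d, l', t', hd, hl', ht', hlen, hlen', e, e'⟩ :=
      exists_common_slot hp hq hpq hl ht hlt (by rintro rfl; simp at hr) h
    rw [cls_twist_btensor_comm] at e e'
    have h' : (btensor l' (twist d p)).Equiv (btensor t' (twist d q)) := by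
      rw [← cls_eq_iff, ← e, ← e', cls_eq_iff]
      exact h
    obtain ⟨s, hs, hs'⟩ := ih (hp.twist hd) (hq.twist hd) (congrArg₂ (· + ·) hpq hpq) hl' ht'
      (by omega) h' (by omega)
    exact ⟨s ++ [d], by rw [e, hs, btensor_append]; rfl, by rw [e', hs', btensor_append]; rfl⟩

end QF

/-- Let `ψ₁`, `ψ₂` be `k`-linked quadratic Pfister forms with
`ψ₁ ≅ ⟨⟨l₁⟩⟩ ⊗ π ≅ ⟨⟨t₁⟩⟩ ⊗ μ` and `ψ₂ ≅ ⟨⟨l₂⟩⟩ ⊗ π ≅ ⟨⟨t₂⟩⟩ ⊗ μ`, where `π`, `μ` are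
`k`-fold quadratic Pfister forms and the `⟨⟨lᵢ⟩⟩`, `⟨⟨tᵢ⟩⟩` are bilinear Pfister forms.
Then `⟨⟨l₁⟩⟩ ⊗ ⟨⟨l₂⟩⟩ ⊗ π ≅ ⟨⟨t₁⟩⟩ ⊗ ⟨⟨t₂⟩⟩ ⊗ μ`, i.e. the invariant `F²_k(ψ₁, ψ₂)`
is well defined up to isometry. -/
theorem pair_invariant_well_defined
    (F : Type) [Field F] (k : ℕ)
    (ψ₁ ψ₂ π μ : QF F)
    (hπ : QF.IsQPfister k π) (hμ : QF.IsQPfister k μ)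
    (l₁ l₂ t₁ t₂ : List F)
    (hul₁ : QF.UnitList l₁) (hul₂ : QF.UnitList l₂)
    (hut₁ : QF.UnitList t₁) (hut₂ : QF.UnitList t₂)
    (h₁ : (QF.btensor l₁ π).Equiv ψ₁) (h₁' : (QF.btensor t₁ μ).Equiv ψ₁)
    (h₂ : (QF.btensor l₂ π).Equiv ψ₂) (h₂' : (QF.btensor t₂ μ).Equiv ψ₂) :
    (QF.btensor l₁ (QF.btensor l₂ π)).Equiv (QF.btensor t₁ (QF.btensor t₂ μ)) := by
  obtain ⟨s, hs, ht⟩ : ∃ s, QF.cls (QF.btensor l₁ π) = QF.cls (QF.btensor s π) ∧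
      QF.cls (QF.btensor t₁ μ) = QF.cls (QF.btensor s μ) := by
    have h : (QF.btensor l₁ π).Equiv (QF.btensor t₁ μ) := h₁.trans h₁'.symm
    have hd : π.dim = μ.dim := hπ.dim_eq.trans hμ.dim_eq.symm
    refine QF.exists_common_cofactor hπ.round hμ.round hd hul₁ hut₁ ?_ h
    have hlen := h.dim_eq
    rw [QF.dim_btensor, QF.dim_btensor, hπ.dim_eq, hμ.dim_eq] at hlen
    exact Nat.pow_right_injective le_rfl (Nat.eq_of_mul_eq_mul_right (by positivity) hlen)
  have h : QF.cls (QF.btensor l₂ π) = QF.cls (QF.btensor t₂ μ) :=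
    QF.cls_eq_iff.2 (h₂.trans h₂'.symm)
  rw [← QF.cls_eq_iff]
  calc QF.cls (QF.btensor l₁ (QF.btensor l₂ π))
      = QF.cls (QF.btensor s (QF.btensor l₂ π)) := by
        rw [QF.cls_btensor_comm, QF.cls_btensor_congr l₂ hs, QF.cls_btensor_comm]
    _ = QF.cls (QF.btensor s (QF.btensor t₂ μ)) := QF.cls_btensor_congr s h
    _ = QF.cls (QF.btensor t₁ (QF.btensor t₂ μ)) := by
        rw [QF.cls_btensor_comm, ← QF.cls_btensor_congr t₂ ht, QF.cls_btensor_comm]
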